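/- The even hyperbolic lattice U ⊕ E₇ ⊕ D₄ ⊕ D₄ (the 2-elementary lattice with invariants (r,a,δ) = (17,5,1)) is not reflective: the subgroup W_r of O(S) generated by reflections in all roots has infinite index in O(S). -/

import Mathlib

open Matrix

/-- The bilinear form on `ℤⁿ` associated to a Gram matrix `G`. -/
def bform {n : ℕ} (G : Matrix (Fin n) (Fin n) ℤ) (x y : Fin n → ℤ) : ℤ :=
  x ⬝ᵥ G.mulVec y

/-- The orthogonal group `O(S)` of the lattice with Gram matrix `G`:
all `ℤ`-module automorphisms preserving the bilinear form. -/
def OrthGroup (n : ℕ) (G : Matrix (Fin n) (Fin n) ℤ) :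
    Subgroup ((Fin n → ℤ) ≃ₗ[ℤ] (Fin n → ℤ)) where
  carrier := {f | ∀ x y, bform G (f x) (f y) = bform G x y}
  one_mem' := fun _ _ => rfl
  mul_mem' := by
    intro f g hf hg x y
    exact (hf (g x) (g y)).trans (hg x y)
  inv_mem' := by
    intro f hf x y
    have h := (hf (f⁻¹ x) (f⁻¹ y)).symm
    rwa [show f (f⁻¹ x) = x from f.apply_symm_apply x,
      show f (f⁻¹ y) = y from f.apply_symm_apply y] at h

/-- A root: a vector of square `-2`, or of square `-4` whose pairing with
the whole lattice is even. -/
def IsRoot {n : ℕ} (G : Matrix (Fin n) (Fin n) ℤ) (α : Fin n → ℤ) : Prop :=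
  bform G α α = -2 ∨ (bform G α α = -4 ∧ ∀ x : Fin n → ℤ, (2 : ℤ) ∣ bform G α x)

/-- `f` is the reflection in a root `α`. -/
def IsReflection {n : ℕ} (G : Matrix (Fin n) (Fin n) ℤ)
    (f : (Fin n → ℤ) ≃ₗ[ℤ] (Fin n → ℤ)) : Prop :=
  ∃ α : Fin n → ℤ, IsRoot G α ∧
    ∀ x : Fin n → ℤ, f x = x - ((2 * bform G x α) / bform G α α) • α

/-- The subgroup `W_r` of `O(S)` generated by the reflections in all roots. -/
def Wr (n : ℕ) (G : Matrix (Fin n) (Fin n) ℤ) : Subgroup ↥(OrthGroup n G) :=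
  Subgroup.closure {f | IsReflection G f.val}

open Matrix

/-- Orthogonal direct sum of two Gram matrices. -/
def dsum {m k : ℕ} (A : Matrix (Fin m) (Fin m) ℤ) (B : Matrix (Fin k) (Fin k) ℤ) :
    Matrix (Fin (m + k)) (Fin (m + k)) ℤ :=
  Matrix.reindex finSumFinEquiv finSumFinEquiv (Matrix.fromBlocks A 0 0 B)

/-- Gram matrix of the hyperbolic plane `U`. -/
def gramU : Matrix (Fin 2) (Fin 2) ℤ := !![0, 1; 1, 0]

/-- Gram matrix of `A₁ = ⟨-2⟩`. -/
def gramA1 : Matrix (Fin 1) (Fin 1) ℤ := !![-2]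

/-- Gram matrix (= negative Cartan matrix) of a simply laced root lattice with
given Dynkin diagram edges. -/
def adjGram (n : ℕ) (E : List (ℕ × ℕ)) : Matrix (Fin n) (Fin n) ℤ :=
  Matrix.of fun i j =>
    if i = j then -2 else if (i.1, j.1) ∈ E ∨ (j.1, i.1) ∈ E then 1 else 0

/-- Gram matrix of the negative definite root lattice `Dₙ`
(in the root basis `e₁+e₂, e₂-e₁, e₃-e₂, …, eₙ-eₙ₋₁` of `{x ∈ ℤⁿ : Σxᵢ even}`
with the negative of the standard Euclidean form). -/
def gramD (n : ℕ) : Matrix (Fin n) (Fin n) ℤ :=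
  adjGram n ((0, 2) :: (List.range (n - 2)).map fun k => (k + 1, k + 2))

/-- Gram matrix (negative Cartan matrix) of `E₈`. -/
def gramE8 : Matrix (Fin 8) (Fin 8) ℤ :=
  adjGram 8 [(0, 2), (1, 3), (2, 3), (3, 4), (4, 5), (5, 6), (6, 7)]

/-- Gram matrix (negative Cartan matrix) of `E₇`. -/
def gramE7 : Matrix (Fin 7) (Fin 7) ℤ :=
  adjGram 7 [(0, 2), (1, 3), (2, 3), (3, 4), (4, 5), (5, 6)]

/-- The Gram matrix of the even 2-elementary hyperbolic lattice `U ⊕ E₇ ⊕ D₄ ⊕ D₄`,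
with invariants `(r,a,δ) = (17,5,1)`. -/
def gramS :=
  dsum gramU (dsum gramE7 (dsum (gramD 4) (gramD 4)))

section Form

variable {n : ℕ} {G : Matrix (Fin n) (Fin n) ℤ}

theorem bform_add_left (x y z : Fin n → ℤ) :
    bform G (x + y) z = bform G x z + bform G y z := add_dotProduct _ _ _

theorem bform_add_right (x y z : Fin n → ℤ) :
    bform G x (y + z) = bform G x y + bform G x z := by
  simp [bform, Matrix.mulVec_add, dotProduct_add]

theorem bform_smul_left (c : ℤ) (x y : Fin n → ℤ) :
    bform G (c • x) y = c * bform G x y := smul_dotProduct _ _ _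

theorem bform_smul_right (c : ℤ) (x y : Fin n → ℤ) :
    bform G x (c • y) = c * bform G x y := by
  rw [bform, mulVec_smul, dotProduct_smul, smul_eq_mul, bform]

theorem bform_neg_left (x y : Fin n → ℤ) : bform G (-x) y = -bform G x y := by
  simp [bform]

theorem bform_neg_right (x y : Fin n → ℤ) : bform G x (-y) = -bform G x y := by
  simp [bform, Matrix.mulVec_neg]

theorem bform_sub_left (x y z : Fin n → ℤ) :
    bform G (x - y) z = bform G x z - bform G y z := sub_dotProduct _ _ _

theorem bform_sub_right (x y z : Fin n → ℤ) :
    bform G x (y - z) = bform G x y - bform G x z := by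
  simp [bform, Matrix.mulVec_sub, dotProduct_sub]

theorem bform_comm (hG : G.IsSymm) (x y : Fin n → ℤ) : bform G x y = bform G y x := by
  rw [bform, bform, dotProduct_mulVec, dotProduct_comm, ← mulVec_transpose, hG.eq]

namespace IsRoot

variable {α : Fin n → ℤ}

theorem bform_self_neg (hα : IsRoot G α) : bform G α α < 0 := by
  rcases hα with h | ⟨h, -⟩ <;> omega

theorem neg (hα : IsRoot G α) : IsRoot G (-α) := by
  simpa [IsRoot, bform_neg_left, bform_neg_right] using hα

theorem map (hα : IsRoot G α) (g : OrthGroup n G) : IsRoot G (g.1 α) := by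
  have hg := g.2
  refine hα.imp (fun h => by rw [hg, h]) fun ⟨h, hd⟩ => ⟨by rw [hg, h], fun x => ?_⟩
  have := hg α (g.1.symm x)
  rw [LinearEquiv.apply_symm_apply] at this
  exact this ▸ hd _

/-- The coefficient of a root reflection is an exact quotient. -/
theorem coeff_mul (hG : G.IsSymm) (hα : IsRoot G α) (x : Fin n → ℤ) :
    2 * bform G x α / bform G α α * bform G α α = 2 * bform G x α := by
  apply Int.ediv_mul_cancel
  rcases hα with h | ⟨h, hd⟩
  · rw [h]; exact ⟨-bform G x α, by ring⟩
  · obtain ⟨k, hk⟩ := hd x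
    rw [h, bform_comm hG x α, hk]; exact ⟨-k, by ring⟩

theorem coeff_eq_iff (hG : G.IsSymm) (hα : IsRoot G α) (x : Fin n → ℤ) (c : ℤ) :
    2 * bform G x α / bform G α α = c ↔ c * bform G α α = 2 * bform G x α := by
  have h := hα.coeff_mul hG x
  exact ⟨fun hc => hc ▸ h, fun hc => mul_right_cancel₀ hα.bform_self_neg.ne (h.trans hc.symm)⟩

/-- The reflection in a root, as an element of the orthogonal group. -/
def reflection (hG : G.IsSymm) (hα : IsRoot G α) : OrthGroup n G :=
  ⟨LinearEquiv.ofInvolutive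
    { toFun := fun x => x - (2 * bform G x α / bform G α α) • α
      map_add' := fun x y => by
        have : 2 * bform G (x + y) α / bform G α α =
            2 * bform G x α / bform G α α + 2 * bform G y α / bform G α α := by
          rw [hα.coeff_eq_iff hG, add_mul, hα.coeff_mul hG, hα.coeff_mul hG, bform_add_left]
          ring
        rw [this]; module
      map_smul' := fun c x => by
        have : 2 * bform G (c • x) α / bform G α α = c * (2 * bform G x α / bform G α α) := by
          rw [hα.coeff_eq_iff hG, mul_assoc, hα.coeff_mul hG, bform_smul_left]
          ring
        rw [this, RingHom.id_apply]; module }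
    (fun x => by
      have : 2 * bform G (x - (2 * bform G x α / bform G α α) • α) α / bform G α α =
          -(2 * bform G x α / bform G α α) := by
        rw [hα.coeff_eq_iff hG, neg_mul, hα.coeff_mul hG, bform_sub_left, bform_smul_left,
          hα.coeff_mul hG]
        ring
      change x - _ • α - (2 * bform G (x - _ • α) α / bform G α α) • α = x
      rw [this]; module),
  fun x y => by
    have hx := hα.coeff_mul hG x
    have hy := hα.coeff_mul hG y
    change bform G (x - _ • α) (y - _ • α) = _
    simp only [bform_sub_left, bform_sub_right, bform_smul_left, bform_smul_right]
    set c := 2 * bform G x α / bform G α α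
    set d := 2 * bform G y α / bform G α α
    rw [bform_comm hG α y]
    have : 2 * (c * bform G y α) = 2 * (d * bform G x α) := by
      linear_combination d * hx - c * hy
    linear_combination d * hx - mul_left_cancel₀ two_ne_zero this⟩

variable (hG : G.IsSymm)

theorem reflection_apply (hα : IsRoot G α) (x : Fin n → ℤ) :
    (hα.reflection hG).1 x = x - (2 * bform G x α / bform G α α) • α := rfl

theorem reflection_self (hα : IsRoot G α) : (hα.reflection hG).1 α = -α := by
  rw [reflection_apply, (hα.coeff_eq_iff hG α 2).2 rfl]; module

theorem reflection_mul_self (hα : IsRoot G α) :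
    hα.reflection hG * hα.reflection hG = 1 := by
  ext1; ext1 x
  exact LinearEquiv.symm_apply_apply (hα.reflection hG).1 x

theorem reflection_map (hα : IsRoot G α) (g : OrthGroup n G) :
    (hα.map g).reflection hG = g * hα.reflection hG * g⁻¹ := by
  ext1; ext1 x
  obtain ⟨y, rfl⟩ := g.1.surjective x
  have hy : (g⁻¹).1 (g.1 y) = y := g.1.symm_apply_apply y
  change ((hα.map g).reflection hG).1 (g.1 y) = g.1 ((hα.reflection hG).1 ((g⁻¹).1 (g.1 y)))
  rw [hy, reflection_apply, reflection_apply, map_sub, map_smul, g.2, g.2]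

theorem reflection_neg (hα : IsRoot G α) : hα.neg.reflection hG = hα.reflection hG := by
  ext1; ext1 x
  have : 2 * bform G x (-α) / bform G (-α) (-α) = -(2 * bform G x α / bform G α α) := by
    rw [hα.neg.coeff_eq_iff hG, bform_neg_left, bform_neg_right, bform_neg_right]
    linear_combination -hα.coeff_mul hG x
  rw [reflection_apply, reflection_apply, this]; module

end IsRoot

theorem IsReflection.exists_eq_reflection (hG : G.IsSymm) {g : OrthGroup n G}
    (hg : IsReflection G g.1) : ∃ (α : _) (hα : IsRoot G α), g = hα.reflection hG := by
  obtain ⟨α, hα, h⟩ := hg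
  exact ⟨α, hα, Subtype.ext (LinearEquiv.ext h)⟩

end Form

section Chamber

variable {n : ℕ} {G : Matrix (Fin n) (Fin n) ℤ}

/-- A vector of positive square with negative definite orthogonal complement which is
orthogonal to no root: an interior point of a chamber. -/
structure IsChamberPoint (G : Matrix (Fin n) (Fin n) ℤ) (p : Fin n → ℤ) : Prop where
  sq_pos : 0 < bform G p p
  neg_of_orthogonal : ∀ x, bform G p x = 0 → x ≠ 0 → bform G x x < 0
  regular : ∀ α, IsRoot G α → bform G p α ≠ 0

/-- A root which is positive with respect to the chamber of `p`. -/
def IsPosRoot (G : Matrix (Fin n) (Fin n) ℤ) (p α : Fin n → ℤ) : Prop :=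
  IsRoot G α ∧ 0 < bform G p α

/-- A positive root whose reflection permutes the other positive roots. -/
def IsSimpleRoot (G : Matrix (Fin n) (Fin n) ℤ) (p α : Fin n → ℤ) : Prop :=
  IsPosRoot G p α ∧ ∀ β, IsPosRoot G p β → β ≠ α →
    0 < bform G p (β - (2 * bform G β α / bform G α α) • α)

/-- The reflections in the simple roots. -/
def simpleReflections (hG : G.IsSymm) (p : Fin n → ℤ) : Set (OrthGroup n G) :=
  {g | ∃ (α : _) (hα : IsRoot G α), IsSimpleRoot G p α ∧ g = hα.reflection hG}

namespace IsChamberPoint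

variable {p : Fin n → ℤ}

theorem sq_le_mul_of_orthogonal (hG : G.IsSymm) (hp : IsChamberPoint G p) {x y : Fin n → ℤ}
    (hx : bform G p x = 0) (hy : bform G p y = 0) :
    bform G x y ^ 2 ≤ bform G x x * bform G y y := by
  rcases eq_or_ne y 0 with rfl | hy0
  · have h0 (z : Fin n → ℤ) : bform G z 0 = 0 := by simp [bform]
    simp [h0]
  have hyy := hp.neg_of_orthogonal y hy hy0
  by_contra! hlt
  let z := bform G y y • x - bform G x y • y
  have hz : bform G p z = 0 := by
    simp only [z, bform_sub_right, bform_smul_right, hx, hy]; ring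
  have hzz : bform G z z = bform G y y * (bform G x x * bform G y y - bform G x y ^ 2) := by
    simp only [z, bform_sub_right, bform_smul_right, bform_sub_left, bform_smul_left,
      bform_comm hG y x]
    ring
  have hpos : 0 < bform G z z := hzz ▸ mul_pos_of_neg_of_neg hyy (by linarith)
  rcases eq_or_ne z 0 with h | h
  · rw [h] at hpos; simp [bform] at hpos
  · exact hpos.not_gt (hp.neg_of_orthogonal z hz h)

/-- The Gram determinant of `p, x, y` is nonnegative. -/
theorem gram_det_nonneg (hG : G.IsSymm) (hp : IsChamberPoint G p) (x y : Fin n → ℤ) :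
    bform G p p * (bform G x y ^ 2 - bform G x x * bform G y y) ≤
      2 * bform G p x * bform G p y * bform G x y - bform G p x ^ 2 * bform G y y
        - bform G p y ^ 2 * bform G x x := by
  have key := hp.sq_le_mul_of_orthogonal hG
    (x := bform G p p • x - bform G p x • p) (y := bform G p p • y - bform G p y • p)
    (by simp only [bform_sub_right, bform_smul_right]; ring)
    (by simp only [bform_sub_right, bform_smul_right]; ring)
  simp only [bform_sub_right, bform_smul_right, bform_sub_left, bform_smul_left,
    bform_comm hG x p, bform_comm hG y p] at key
  have h := hp.sq_pos
  refine le_of_mul_le_mul_left ?_ (pow_pos h 3)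
  linarith

theorem height_lt (hG : G.IsSymm) (hp : IsChamberPoint G p) {α β : Fin n → ℤ}
    (hα : IsPosRoot G p α) (hβ : IsPosRoot G p β) (hne : α ≠ β)
    (h : bform G p α * bform G α β ≤ bform G p β * bform G α α) :
    bform G p α * bform G β β < bform G p β * bform G α β := by
  obtain ⟨hα, ha⟩ := hα
  obtain ⟨hβ, hb⟩ := hβ
  have hdet := hp.gram_det_nonneg hG α β
  have hA := hα.bform_self_neg
  have hB := hβ.bform_self_neg
  have hH := hp.sq_pos
  by_contra! hle
  set a := bform G p α
  set b := bform G p β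
  set m := bform G α β with hm
  have hA4 : bform G α α = -2 ∨ bform G α α = -4 := hα.imp_right And.left
  have hB4 : bform G β β = -2 ∨ bform G β β = -4 := hβ.imp_right And.left
  have hm0 : m < 0 := by
    by_contra! h0
    nlinarith [mul_nonneg hb.le h0, mul_pos_of_neg_of_neg hB (neg_neg_of_pos ha)]
  have h1 : bform G α α * bform G β β ≤ m ^ 2 := by
    have : (a * b) * (bform G α α * bform G β β) ≤ (a * b) * m ^ 2 := by
      have h2 := mul_le_mul (neg_le_neg h) (neg_le_neg hle)
        (by nlinarith) (by nlinarith)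
      linarith
    exact le_of_mul_le_mul_left this (mul_pos ha hb)
  have hsum : 2 * a * b * m - a ^ 2 * bform G β β - b ^ 2 * bform G α α ≤ 0 := by
    nlinarith [mul_nonneg ha.le (sub_nonneg.2 hle), mul_nonneg hb.le (sub_nonneg.2 h)]
  have h2 : m ^ 2 ≤ bform G α α * bform G β β := by
    by_contra! hc
    nlinarith [mul_pos hH (sub_pos.2 hc)]
  have h3 : m ^ 2 = bform G α α * bform G β β := le_antisymm h2 h1
  have hm5 : -5 < m := by
    rcases hA4 with h4 | h4 <;> rcases hB4 with h5 | h5 <;> rw [h4, h5] at h3 <;> nlinarith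
  have : bform G α α = m ∧ bform G β β = m := by
    rcases hA4 with h4 | h4 <;> rcases hB4 with h5 | h5 <;> rw [h4, h5] at h3 ⊢ <;>
      interval_cases m <;> omega
  obtain ⟨h4, h5⟩ := this
  rw [h4] at h
  rw [h5] at hle
  have hab : a = b := le_antisymm (by nlinarith) (by nlinarith)
  have := hp.neg_of_orthogonal (α - β) (by rw [bform_sub_right]; exact sub_eq_zero.2 hab)
    (sub_ne_zero.2 hne)
  simp only [bform_sub_left, bform_sub_right, bform_comm hG β α, h4, h5] at this
  rw [← hm] at this
  omega

end IsChamberPoint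


/-- Eight times the squared height of a root divided by minus its square. -/
def depth (G : Matrix (Fin n) (Fin n) ℤ) (p α : Fin n → ℤ) : ℕ :=
  ((6 + bform G α α) * bform G p α ^ 2).toNat

theorem depth_lt_depth {p α β : Fin n → ℤ} (hα : IsRoot G α) (hβ : IsRoot G β)
    (h : bform G p α ^ 2 * bform G β β < bform G p β ^ 2 * bform G α α) :
    depth G p β < depth G p α := by
  have hA : bform G α α = -2 ∨ bform G α α = -4 := hα.imp_right And.left
  have hB : bform G β β = -2 ∨ bform G β β = -4 := hβ.imp_right And.left
  have := sq_nonneg (bform G p α)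
  have := sq_nonneg (bform G p β)
  unfold depth
  rcases hA with hA | hA <;> rcases hB with hB | hB <;> rw [hA, hB] at h ⊢ <;> omega

theorem IsPosRoot.map {p α : Fin n → ℤ} (hα : IsRoot G α) (g : OrthGroup n G)
    (h : 0 < bform G p (g.1 α)) : IsPosRoot G p (g.1 α) := ⟨hα.map g, h⟩

/-- The exchange condition. -/
theorem IsPosRoot.exists_exchange (hG : G.IsSymm) {p α : Fin n → ℤ} (hα : IsPosRoot G p α)
    (l : List (OrthGroup n G))
    (hl : ∀ g ∈ l, g ∈ simpleReflections hG p) (hneg : ¬ 0 < bform G p (l.prod.1 α)) :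
    ∃ l' : List (OrthGroup n G), (∀ g ∈ l', g ∈ simpleReflections hG p) ∧
      l'.length < l.length ∧ l.prod = l'.prod * hα.1.reflection hG := by
  induction l with
  | nil => exact absurd hα.2 hneg
  | cons s t ih =>
    rw [List.forall_mem_cons] at hl
    by_cases ht : 0 < bform G p (t.prod.1 α)
    · obtain ⟨β, hβ, hsβ, rfl⟩ := hl.1
      have heq : t.prod.1 α = β := by
        by_contra hne
        exact hneg (hsβ.2 _ (.map hα.1 _ ht) hne)
      subst heq
      refine ⟨t, hl.2, by simp, ?_⟩
      rw [List.prod_cons, hα.1.reflection_map hG]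
      group
    · obtain ⟨l', h1, h2, h3⟩ := ih hl.2 ht
      refine ⟨s :: l', List.forall_mem_cons.2 ⟨hl.1, h1⟩, by simpa, ?_⟩
      rw [List.prod_cons, List.prod_cons, h3, mul_assoc]

theorem simpleReflections_prod_eq_one (hG : G.IsSymm) {p : Fin n → ℤ}
    (l : List (OrthGroup n G)) (hl : ∀ g ∈ l, g ∈ simpleReflections hG p)
    (hpos : ∀ α, IsPosRoot G p α → 0 < bform G p (l.prod.1 α)) : l.prod = 1 := by
  induction hk : l.length using Nat.strong_induction_on generalizing l with
  | _ k ih =>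
  rcases l.eq_nil_or_concat with rfl | ⟨t, s, rfl⟩
  · rfl
  rw [List.concat_eq_append] at *
  obtain ⟨α, hα, hs, rfl⟩ := hl s (by simp)
  have hneg : ¬ 0 < bform G p (t.prod.1 α) := by
    have h := hpos α hs.1
    have : (t ++ [hα.reflection hG]).prod.1 α = -t.prod.1 α := by
      rw [List.prod_append, List.prod_singleton, ← map_neg, ← hα.reflection_self hG]
      rfl
    rw [this, bform_neg_right] at h
    omega
  obtain ⟨l', h1, h2, h3⟩ := hs.1.exists_exchange hG t (fun g hg => hl g (by simp [hg])) hneg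
  have hprod : (t ++ [hα.reflection hG]).prod = l'.prod := by
    rw [List.prod_append, List.prod_singleton, h3, mul_assoc, IsRoot.reflection_mul_self, mul_one]
  rw [hprod] at hpos ⊢
  exact ih _ (by simp at hk; omega) l' h1 hpos rfl

namespace IsChamberPoint

variable {p : Fin n → ℤ}

theorem pos_or_neg (hp : IsChamberPoint G p) {α : Fin n → ℤ} (hα : IsRoot G α) :
    IsPosRoot G p α ∨ IsPosRoot G p (-α) := by
  rcases (hp.regular α hα).lt_or_gt with h | h
  · exact .inr ⟨hα.neg, by rw [bform_neg_right]; omega⟩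
  · exact .inl ⟨hα, h⟩

theorem descent_aux (hG : G.IsSymm) (hp : IsChamberPoint G p) {α β : Fin n → ℤ}
    (hα : IsPosRoot G p α) (hβ : IsPosRoot G p β) (hne : β ≠ α)
    (h : bform G p α * bform G α β ≤ bform G p β * bform G α α) :
    depth G p β < depth G p α ∧ depth G p ((hβ.1.reflection hG).1 α) < depth G p α := by
  have hlt := hp.height_lt hG hα hβ hne.symm h
  have hc := hβ.1.coeff_mul hG α
  have hA := hα.1.bform_self_neg
  have hB := hβ.1.bform_self_neg
  have ha := hα.2
  have hb := hβ.2
  constructor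
  · apply depth_lt_depth hα.1 hβ.1
    nlinarith [mul_lt_mul_of_pos_left hlt ha, mul_le_mul_of_nonneg_left h hb.le]
  · apply depth_lt_depth hα.1 (hα.1.map _)
    rw [(hβ.1.reflection hG).2, IsRoot.reflection_apply, bform_sub_right, bform_smul_right]
    set c := 2 * bform G α β / bform G β β
    refine mul_lt_mul_of_neg_right ?_ hA
    have hm : bform G α β < 0 := by
      by_contra! h0
      nlinarith [mul_nonneg ha.le h0, mul_neg_of_pos_of_neg hb hA]
    have hc0 : 0 < c := by
      by_contra! h0
      nlinarith [mul_nonneg_of_nonpos_of_nonpos h0 hB.le]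
    have h2 : c * bform G p β < 2 * bform G p α := by
      refine lt_of_mul_lt_mul_right (a := -bform G β β) ?_ (by omega)
      linear_combination 2 * hlt - bform G p β * hc
    nlinarith [mul_pos hc0 hb]

theorem exists_descent (hG : G.IsSymm) (hp : IsChamberPoint G p) {α : Fin n → ℤ}
    (hα : IsPosRoot G p α) (hs : ¬ IsSimpleRoot G p α) :
    ∃ β, ∃ hβ : IsPosRoot G p β, depth G p β < depth G p α ∧
      depth G p ((hβ.1.reflection hG).1 α) < depth G p α := by
  simp only [IsSimpleRoot, hα, true_and, not_forall, not_lt] at hs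
  obtain ⟨β, hβ, hne, hle⟩ := hs
  have hc := hα.1.coeff_mul hG β
  have hγ : IsPosRoot G p (-(hα.1.reflection hG).1 β) :=
    (hp.pos_or_neg (hβ.1.map _)).resolve_left fun h => h.2.not_ge hle
  rw [IsRoot.reflection_apply] at hγ
  set c := 2 * bform G β α / bform G α α
  have hA := hα.1.bform_self_neg
  rcases le_total (2 * bform G p β) (c * bform G p α) with h | h
  · refine ⟨β, hβ, hp.descent_aux hG hα hβ hne ?_⟩
    rw [bform_comm hG α β]
    refine le_of_mul_le_mul_left ?_ two_pos
    linear_combination mul_le_mul_of_nonpos_right h hA.le - bform G p α * hc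
  · refine ⟨_, hγ, hp.descent_aux hG hα hγ (fun he => hne ?_) ?_⟩
    · have h2 : (hα.1.reflection hG).1 β = (hα.1.reflection hG).1 α := by
        rw [IsRoot.reflection_self, IsRoot.reflection_apply, ← he, neg_neg, he]
      exact (hα.1.reflection hG).1.injective h2
    · simp only [bform_neg_right, bform_sub_right, bform_smul_right]
      rw [bform_comm hG α β]
      refine le_of_mul_le_mul_left ?_ two_pos
      linear_combination mul_le_mul_of_nonpos_right h hA.le + bform G p α * hc

theorem reflection_mem_closure (hG : G.IsSymm) (hp : IsChamberPoint G p) {α : Fin n → ℤ}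
    (hα : IsRoot G α) :
    hα.reflection hG ∈ Subgroup.closure (simpleReflections hG p) := by
  induction hk : depth G p α using Nat.strong_induction_on generalizing α with
  | _ k ih =>
  wlog hpos : IsPosRoot G p α generalizing α
  · rw [← hα.reflection_neg hG]
    refine this hα.neg ?_ ((hp.pos_or_neg hα).resolve_left hpos)
    simpa [depth, bform_neg_left, bform_neg_right] using hk
  by_cases hs : IsSimpleRoot G p α
  · exact Subgroup.subset_closure ⟨α, hα, hs, rfl⟩
  obtain ⟨β, hβ, h1, h2⟩ := hp.exists_descent hG hpos hs
  have hβm := ih _ (hk ▸ h1) hβ.1 rfl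
  have hδm := ih _ (hk ▸ h2) (hα.map (hβ.1.reflection hG)) rfl
  rw [IsRoot.reflection_map] at hδm
  simpa [mul_assoc] using mul_mem (mul_mem (inv_mem hβm) hδm) hβm

/-- An element of the reflection group preserving the positive roots is trivial. -/
theorem eq_one_of_mem_Wr (hG : G.IsSymm) (hp : IsChamberPoint G p) {w : OrthGroup n G}
    (hw : w ∈ Wr n G) (hpos : ∀ α, IsPosRoot G p α → 0 < bform G p (w.1 α)) : w = 1 := by
  have hle : Wr n G ≤ Subgroup.closure (simpleReflections hG p) := by
    refine (Subgroup.closure_le _).2 fun g hg => ?_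
    obtain ⟨α, hα, rfl⟩ := IsReflection.exists_eq_reflection hG hg
    exact hp.reflection_mem_closure hG hα
  have hw' := hle hw
  rw [← Subgroup.mem_toSubmonoid, Subgroup.closure_toSubmonoid] at hw'
  obtain ⟨l, hl, rfl⟩ := Submonoid.exists_list_of_mem_closure hw'
  refine simpleReflections_prod_eq_one hG l (fun g hg => (hl g hg).elim id ?_) hpos
  rintro ⟨α, hα, hs, h⟩
  exact ⟨α, hα, hs, by rw [← inv_inv g, h, inv_eq_of_mul_eq_one_left (hα.reflection_mul_self hG)]⟩

end IsChamberPoint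

end Chamber

section Eichler

variable {n : ℕ} {G : Matrix (Fin n) (Fin n) ℤ}

/-- The Eichler transvection of an isotropic vector `e` and a vector `v` orthogonal to `e`
of square `2 * c`. -/
def eichler (hG : G.IsSymm) (e v : Fin n → ℤ) (c : ℤ) (he : bform G e e = 0)
    (hev : bform G e v = 0) (hv : bform G v v = 2 * c) : OrthGroup n G :=
  have hve : bform G v e = 0 := (bform_comm hG v e).trans hev
  ⟨LinearEquiv.ofLinearMap
    { toFun := fun x => x + bform G e x • v - (bform G v x + c * bform G e x) • e
      map_add' := fun x y => by simp only [bform_add_right]; module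
      map_smul' := fun a x => by simp only [bform_smul_right, RingHom.id_apply]; module }
    { toFun := fun x => x - bform G e x • v + (bform G v x - c * bform G e x) • e
      map_add' := fun x y => by simp only [bform_add_right]; module
      map_smul' := fun a x => by simp only [bform_smul_right, RingHom.id_apply]; module }
    (by
      refine LinearMap.ext fun x => ?_
      simp only [LinearMap.comp_apply, LinearMap.coe_mk, AddHom.coe_mk, bform_add_right,
        bform_sub_right, bform_smul_right, he, hev, hve, hv, LinearMap.id_apply]
      module)
    (by
      refine LinearMap.ext fun x => ?_
      simp only [LinearMap.comp_apply, LinearMap.coe_mk, AddHom.coe_mk, bform_add_right,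
        bform_sub_right, bform_smul_right, he, hev, hve, hv, LinearMap.id_apply]
      module),
  fun x y => by
    change bform G (x + bform G e x • v - (bform G v x + c * bform G e x) • e)
      (y + bform G e y • v - (bform G v y + c * bform G e y) • e) = _
    simp only [bform_add_right, bform_sub_right, bform_smul_right, bform_add_left, bform_sub_left,
      bform_smul_left, he, hev, hve, hv, bform_comm hG x v, bform_comm hG x e]
    ring⟩

theorem eichler_apply (hG : G.IsSymm) {e v : Fin n → ℤ} {c : ℤ} (he : bform G e e = 0)
    (hev : bform G e v = 0) (hv : bform G v v = 2 * c) (x : Fin n → ℤ) :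
    (eichler hG e v c he hev hv).1 x =
      x + bform G e x • v - (bform G v x + c * bform G e x) • e := rfl

/-- If the roots orthogonal to a cusp `e` of a chamber are orthogonal to some `v ∈ e^⊥` with
`v² ≠ 0`, the lattice is not reflective: the Eichler transvection of `e` and `v` has infinite
order and preserves the chamber. -/
theorem not_finiteIndex_Wr_of_cusp (hG : G.IsSymm) {p e v : Fin n → ℤ} {c : ℤ}
    (hp : IsChamberPoint G p) (he0 : e ≠ 0) (he : bform G e e = 0) (hev : bform G e v = 0)
    (hv : bform G v v = 2 * c) (hc : c ≠ 0)
    (hcusp : ∀ α, IsRoot G α → 0 < bform G e α → 0 < bform G p α)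
    (horth : ∀ α, IsRoot G α → bform G e α = 0 → bform G v α = 0) :
    ¬ (Wr n G).FiniteIndex := by
  intro hfin
  set g := eichler hG e v c he hev hv
  have hgpos (α) (hα : IsPosRoot G p α) : IsPosRoot G p (g.1 α) := by
    rcases lt_trichotomy (bform G e α) 0 with h | h | h
    · have := hcusp _ hα.1.neg (by rw [bform_neg_right]; omega)
      rw [bform_neg_right] at this
      exact absurd hα.2 (by omega)
    · have : g.1 α = α := by rw [eichler_apply, h, horth α hα.1 h]; module
      rwa [this]
    · refine .map hα.1 g (hcusp _ (hα.1.map g) ?_)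
      rw [eichler_apply]
      simpa only [bform_add_right, bform_sub_right, bform_smul_right, he, hev, mul_zero, add_zero,
        sub_zero]
  have hpow (k : ℕ) (α) (hα : IsPosRoot G p α) : IsPosRoot G p ((g ^ k).1 α) := by
    induction k with
    | zero => exact hα
    | succ k ih => rw [pow_succ']; exact hgpos _ ih
  have hpowv (k : ℕ) : (g ^ k).1 v = v - (k * (2 * c)) • e := by
    induction k with
    | zero => simp
    | succ k ih =>
      rw [pow_succ']
      change g.1 ((g ^ k).1 v) = _
      rw [ih, eichler_apply]
      simp only [bform_sub_right, bform_smul_right, he, hev, hv, bform_comm hG v e]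
      push_cast
      module
  obtain ⟨k, hk, -, hmem⟩ := Subgroup.exists_pow_mem_of_index_ne_zero hfin.index_ne_zero g
  have h1 := hp.eq_one_of_mem_Wr hG hmem fun α hα => (hpow k α hα).2
  have h2 := hpowv k
  rw [h1] at h2
  have h3 : ((k : ℤ) * (2 * c)) • e = 0 := sub_eq_self.1 h2.symm
  rcases smul_eq_zero.1 h3 with h | h
  · have : (k : ℤ) ≠ 0 := by exact_mod_cast hk.ne'
    simp_all
  · exact he0 h

end Eichler

section CuspArithmetic

theorem mul_self_le_mul_self_of_le_or_le_neg {a c : ℤ} (hc : 0 ≤ c)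
    (h : c ≤ a ∨ a ≤ -c) : c * c ≤ a * a := by
  rcases h with h | h <;> nlinarith

theorem dotProduct_self_nonneg_int {m : ℕ} (x : Fin m → ℤ) : 0 ≤ x ⬝ᵥ x :=
  Finset.sum_nonneg fun i _ => mul_self_nonneg (x i)

theorem mul_self_le_dotProduct_self {m : ℕ} (x : Fin m → ℤ) (i : Fin m) :
    x i * x i ≤ x ⬝ᵥ x :=
  Finset.single_le_sum (f := fun i => x i * x i) (fun i _ => mul_self_nonneg (x i))
    (Finset.mem_univ i)

theorem mul_add_one_nonneg (k : ℤ) : 0 ≤ k * (k + 1) := by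
  rcases le_or_gt 0 k with h | h <;> nlinarith

/-- A balanced base-`32` expansion which is divisible by the next power of `32` is trivial. -/
theorem eq_zero_of_sum_base_eq {m : ℕ} {d : Fin m → ℤ} {Y : ℤ} (hd : ∀ i, |d i| ≤ 15)
    (h : ∑ i, 32 ^ i.1 * d i = 32 ^ m * Y) : d = 0 := by
  induction m with
  | zero => exact Subsingleton.elim _ _
  | succ m ih =>
    have hsum : ∑ i : Fin m, 32 ^ (i.1 + 1) * d i.succ =
        32 * ∑ i : Fin m, 32 ^ i.1 * d i.succ := by
      rw [Finset.mul_sum]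
      exact Finset.sum_congr rfl fun i _ => by ring
    simp only [Fin.sum_univ_succ, Fin.val_zero, pow_zero, one_mul, Fin.val_succ, hsum] at h
    have hm : (32 : ℤ) ^ (m + 1) * Y = 32 * (32 ^ m * Y) := by ring
    have h0 := abs_le.1 (hd 0)
    have ih := ih (d := fun i => d i.succ) (fun i => hd _) (by omega)
    ext i
    refine Fin.cases ?_ (fun i => congrFun ih i) i
    change d 0 = 0
    omega

variable {A : Fin 10 → ℤ} {B C : Fin 3 → ℤ}

/-- A vector satisfying the congruences of the discriminant gluing at the cusp, whose norm is
that of a root, has vanishing `B`-component sum. -/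
theorem sum_eq_zero_of_root_norm (hA : ∀ i, 4 ∣ A i - A 0) (hB : ∀ j, 4 ∣ B j - A 0)
    (hs : ∑ i, A i + 2 * ∑ j, B j = 0) (hC : 2 ∣ ∑ l, C l - A 0)
    (hT : A ⬝ᵥ A + 2 * (B ⬝ᵥ B) + 16 * (C ⬝ᵥ C) = 32 ∨
      A ⬝ᵥ A + 2 * (B ⬝ᵥ B) + 16 * (C ⬝ᵥ C) = 64 ∧ (∀ i, 8 ∣ A i - A 0) ∧
        ∀ l, 2 ∣ C l - C 0) : ∑ j, B j = 0 := by
  have hAA : 0 ≤ A ⬝ᵥ A := dotProduct_self_nonneg_int A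
  have hBB : 0 ≤ B ⬝ᵥ B := dotProduct_self_nonneg_int B
  have hCC : 0 ≤ C ⬝ᵥ C := dotProduct_self_nonneg_int C
  have hAi (i : Fin 10) : A i * A i ≤ A ⬝ᵥ A :=
    mul_self_le_dotProduct_self A i
  have hBj (j : Fin 3) : B j * B j ≤ B ⬝ᵥ B :=
    mul_self_le_dotProduct_self B j
  have bound (s t t' : ℤ) (hAs : ∀ i, 0 ≤ A i * A i + s * A i + t)
      (hBs : ∀ i, 0 ≤ B i * B i + s * B i + t') :
      0 ≤ A ⬝ᵥ A + 2 * (B ⬝ᵥ B) + 10 * t + 6 * t' := by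
    have h1 := Finset.sum_nonneg fun i (_ : i ∈ Finset.univ) => hAs i
    have h2 := Finset.sum_nonneg fun i (_ : i ∈ Finset.univ) => hBs i
    simp only [Finset.sum_add_distrib, ← Finset.mul_sum, Finset.sum_const, Finset.card_univ,
      Fintype.card_fin, nsmul_eq_mul] at h1 h2
    push_cast at h1 h2
    simp only [dotProduct]
    linear_combination h1 + 2 * h2 + s * hs
  have hodd (h48 : 48 ≤ A ⬝ᵥ A + 2 * (B ⬝ᵥ B)) (h0 : ¬ 2 ∣ A 0) : False := by
    rcases hT with hT | ⟨hT, -, hCp⟩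
    · omega
    · have h1 := hCp 1
      have h2 := hCp 2
      simp only [Fin.sum_univ_three] at hC
      have hpos (c : ℤ) (hc : ¬ 2 ∣ c) : 1 ≤ c * c :=
        mul_self_le_mul_self_of_le_or_le_neg zero_le_one (by omega)
      have h0 := hpos (C 0) (by omega)
      have h1 := hpos (C 1) (by omega)
      have h2 := hpos (C 2) (by omega)
      have : C ⬝ᵥ C = C 0 * C 0 + C 1 * C 1 + C 2 * C 2 := Fin.sum_univ_three _
      omega
  obtain h | h | h | h : A 0 % 4 = 1 ∨ A 0 % 4 = 3 ∨ A 0 % 4 = 2 ∨ A 0 % 4 = 0 := by omega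
  · have key (a : ℤ) (ha : 4 ∣ a - A 0) : 0 ≤ a * a + 2 * a + -3 := by
      obtain ⟨k, rfl⟩ : ∃ k, a = 4 * k + 1 := ⟨a / 4, by omega⟩
      linear_combination 16 * mul_add_one_nonneg k
    have := bound 2 (-3) (-3) (fun i => key _ (hA i)) fun j => key _ (hB j)
    exact (hodd (by omega) (by omega)).elim
  · have key (a : ℤ) (ha : 4 ∣ a - A 0) : 0 ≤ a * a + -2 * a + -3 := by
      obtain ⟨k, rfl⟩ : ∃ k, a = 4 * k + 3 := ⟨a / 4, by omega⟩
      linear_combination 16 * mul_add_one_nonneg k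
    have := bound (-2) (-3) (-3) (fun i => key _ (hA i)) fun j => key _ (hB j)
    exact (hodd (by omega) (by omega)).elim
  · exfalso
    have key (a : ℤ) (ha : 4 ∣ a - A 0) : 0 ≤ a * a + 0 * a + -4 := by
      have := mul_self_le_mul_self_of_le_or_le_neg (a := a) zero_le_two (by omega)
      omega
    have := bound 0 (-4) (-4) (fun i => key _ (hA i)) fun j => key _ (hB j)
    rcases hT with hT | ⟨hT, hA8, -⟩
    · omega
    obtain h8 | h8 : A 0 % 8 = 2 ∨ A 0 % 8 = 6 := by omega
    · have := bound 4 (-12) 4 (fun i => by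
        obtain ⟨k, hk⟩ : ∃ k, A i = 8 * k + 2 := ⟨A i / 8, by have := hA8 i; omega⟩
        rw [hk]; linear_combination 64 * mul_add_one_nonneg k)
        fun j => by linear_combination mul_self_nonneg (B j + 2)
      omega
    · have := bound (-4) (-12) 4 (fun i => by
        obtain ⟨k, hk⟩ : ∃ k, A i = 8 * k + 6 := ⟨A i / 8, by have := hA8 i; omega⟩
        rw [hk]; linear_combination 64 * mul_add_one_nonneg k)
        fun j => by linear_combination mul_self_nonneg (B j - 2)
      omega
  · by_contra hne
    have hA0 : A ≠ 0 := by
      rintro rfl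
      simp at hs
      exact hne hs
    obtain ⟨j, -, hj⟩ := Finset.exists_ne_zero_of_sum_ne_zero hne
    obtain ⟨i, hi⟩ := Function.ne_iff.1 hA0
    rw [Pi.zero_apply] at hi
    have hAp : 0 < A ⬝ᵥ A :=
      hAA.lt_of_ne fun h0 => hA0 (dotProduct_self_eq_zero.1 h0.symm)
    have hj16 : 4 * 4 ≤ B j * B j :=
      mul_self_le_mul_self_of_le_or_le_neg (by norm_num) (by have := hB j; omega)
    have := hBj j
    rcases hT with hT | ⟨hT, hA8, -⟩
    · omega
    obtain h8 | h8 : A 0 % 8 = 4 ∨ A 0 % 8 = 0 := by omega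
    · have := bound 0 (-16) 0 (fun i => by
        have := mul_self_le_mul_self_of_le_or_le_neg (a := A i) (c := 4)
          (by norm_num) (by have := hA8 i; omega)
        omega) fun j => by linear_combination mul_self_nonneg (B j)
      omega
    · have := mul_self_le_mul_self_of_le_or_le_neg (a := A i) (c := 8)
        (by norm_num) (by have := hA8 i; omega)
      have := hAi i
      omega

end CuspArithmetic

section Cusp

/-- The Gram matrix of `U ⊕ E₇ ⊕ D₄ ⊕ D₄` on `ℤ¹⁷`. -/
def latticeGram : Matrix (Fin 17) (Fin 17) ℤ := gramS

/-- The primitive isotropic vector spanning the cusp. -/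
def cusp : Fin 17 → ℤ := ![3, 3, 0, -1, 0, 0, 0, -1, 1, 0, 0, 1, -1, -1, 0, 0, -1]

/-- An isotropic vector with `⟨cusp, coCusp⟩ = 1`. -/
def coCusp : Fin 17 → ℤ := ![3, 3, 0, -1, 0, -1, 0, -1, 1, 0, 0, 1, -1, -1, 0, 0, -1]

/-- The direction of an Eichler transvection at the cusp which is orthogonal to all roots
in `cusp^⊥`. -/
def translation : Fin 17 → ℤ := ![-12, -12, 0, 6, 0, 0, -6, 0, -6, 0, 0, -4, 4, 3, 0, 0, 3]

/-- Coordinates on the component `A₉` of the root system of the cusp. -/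
def coordA : Matrix (Fin 10) (Fin 17) ℤ :=
  !![6, 6, 4, 2, -4, 0, -2, 6, -6, 2, 2, -6, 6, 5, 0, -5, 5;
    6, 6, -4, 2, 0, 0, -2, 6, -6, 2, 2, -6, 6, 5, 0, -5, 5;
    -6, -6, 0, -6, 4, 0, 2, -6, 6, -2, -2, 6, -6, -3, 0, 3, -3;
    -2, -2, 0, -2, 0, 0, 2, -2, 2, 2, 2, -2, -2, -3, 0, 3, -3;
    6, 6, 0, 2, 0, 0, -2, 6, -6, 2, 2, -6, 6, 5, 0, -5, 5;
    -2, -2, 0, -2, 0, 0, 2, -2, 2, -2, -2, 2, 2, -3, 0, 3, -3;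
    -2, -6, 0, -2, 0, 0, 2, -2, 2, -2, -2, 6, -6, -3, 0, 3, -3;
    -6, -2, 0, -2, 0, 0, 2, -2, 2, -2, -2, 6, -6, -3, 0, 3, -3;
    -6, -6, 0, -2, 0, 0, 6, -10, 6, -2, -2, 6, -6, -3, 0, 3, -3;
    -6, -6, 0, -2, 0, 0, 2, -6, 10, -2, -2, 6, -6, -3, 0, 3, -3]

/-- Coordinates on the component of the root system of the cusp which is embedded diagonally
(and hence has multiplicity two). -/
def coordB : Matrix (Fin 3) (Fin 17) ℤ :=
  !![2, 2, 0, 2, 0, 0, -2, 2, -2, 2, 2, -2, 2, 1, 0, -1, 1;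
    2, 2, 0, 2, 0, 0, -2, 2, -2, -2, 2, -2, 2, 1, 0, -1, 1;
    2, 2, 0, 2, 0, 0, -2, 2, -2, 2, -2, -2, 2, 1, 0, -1, 1]

/-- Coordinates on the component `A₃ = D₃` of the root system of the cusp. -/
def coordC : Matrix (Fin 3) (Fin 17) ℤ :=
  !![0, 0, 0, 0, 0, 0, 0, 0, 0, 0, 0, 0, 0, 0, -1, 1, 0;
    0, 0, 0, 0, 0, 0, 0, 0, 0, 0, 0, 0, 0, 0, -1, 0, 0;
    0, 0, 0, 0, 0, 0, 0, 0, 0, 0, 0, 0, 0, 1, 0, 0, -1]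

/-- Vectors of `cusp^⊥` supported on `coordA`, with coordinates `4 (eᵢ - e₀)`. -/
def vecA : Matrix (Fin 10) (Fin 17) ℤ :=
  !![0, 0, 0, 0, 0, 0, 0, 0, 0, 0, 0, 0, 0, 0, 0, 0, 0;
    0, 0, -1, 0, 0, 0, 0, 0, 0, 0, 0, 0, 0, 0, 0, 0, 0;
    3, 3, 0, -1, 1, 0, 0, -1, 1, 0, 0, 1, -1, -1, 0, 0, -1;
    2, 2, 0, 0, 1, 1, 1, 0, 1, 0, 0, 0, -1, -1, 0, 0, -1;
    0, 0, 1, 2, 3, 4, 3, 2, 1, 0, 0, 0, 0, 0, 0, 0, 0;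
    2, 2, 0, 0, 1, 1, 1, 0, 1, 0, 0, 1, 0, -1, 0, 0, -1;
    3, 2, 0, 0, 1, 1, 1, 0, 1, 0, 0, 1, -1, -1, 0, 0, -1;
    2, 3, 0, 0, 1, 1, 1, 0, 1, 0, 0, 1, -1, -1, 0, 0, -1;
    3, 3, 0, 0, 1, 1, 1, -1, 1, 0, 0, 1, -1, -1, 0, 0, -1;
    3, 3, 0, 0, 1, 1, 1, 0, 2, 0, 0, 1, -1, -1, 0, 0, -1]

/-- Vectors of `cusp^⊥` supported on `coordC`, with coordinates `eₗ - e₀`. -/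
def vecC : Matrix (Fin 3) (Fin 17) ℤ :=
  !![0, 0, 0, 0, 0, 0, 0, 0, 0, 0, 0, 0, 0, 0, 0, 0, 0;
    0, 0, 0, 0, 0, 0, 0, 0, 0, 0, 0, 0, 0, -1, -1, -2, -1;
    0, 0, 0, 0, 0, 0, 0, 0, 0, 0, 0, 0, 0, 0, 0, -1, -1]

/-- Twice the inverse of `latticeGram`. -/
def latticeGramInv : Matrix (Fin 17) (Fin 17) ℤ :=
  dsum (2 • gramU) (dsum
    !![-4, -4, -6, -8, -6, -4, -2;
    -4, -7, -8, -12, -9, -6, -3;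
    -6, -8, -12, -16, -12, -8, -4;
    -8, -12, -16, -24, -18, -12, -6;
    -6, -9, -12, -18, -15, -10, -5;
    -4, -6, -8, -12, -10, -8, -4;
    -2, -3, -4, -6, -5, -4, -3] (dsum
    !![-2, -1, -2, -1;
    -1, -2, -2, -1;
    -2, -2, -4, -2;
    -1, -1, -2, -2]
    !![-2, -1, -2, -1;
    -1, -2, -2, -1;
    -2, -2, -4, -2;
    -1, -1, -2, -2]))

theorem latticeGram_isSymm : latticeGram.IsSymm := by
  unfold Matrix.IsSymm
  decide +kernel

theorem latticeGramInv_mul_latticeGram : latticeGramInv * latticeGram = 2 := by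
  decide +kernel

theorem latticeGram_eq : (16 : ℤ) • latticeGram =
    (16 : ℤ) • (vecMulVec (latticeGram *ᵥ cusp) (latticeGram *ᵥ coCusp) +
      vecMulVec (latticeGram *ᵥ coCusp) (latticeGram *ᵥ cusp)) -
    (coordAᵀ * coordA + (2 : ℤ) • (coordBᵀ * coordB) + (16 : ℤ) • (coordCᵀ * coordC)) := by
  decide +kernel

theorem sixteen_mul_bform (x y : Fin 17 → ℤ) :
    16 * bform latticeGram x y =
      16 * (bform latticeGram cusp x * bform latticeGram coCusp y +
        bform latticeGram coCusp x * bform latticeGram cusp y) -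
      ((coordA *ᵥ x) ⬝ᵥ (coordA *ᵥ y) + 2 * ((coordB *ᵥ x) ⬝ᵥ (coordB *ᵥ y)) +
        16 * ((coordC *ᵥ x) ⬝ᵥ (coordC *ᵥ y))) := by
  have h := congrArg (fun M => x ⬝ᵥ M *ᵥ y) latticeGram_eq
  have htr {m : ℕ} (M : Matrix (Fin m) (Fin 17) ℤ) :
      x ⬝ᵥ (Mᵀ * M) *ᵥ y = (M *ᵥ x) ⬝ᵥ (M *ᵥ y) := by
    rw [← mulVec_mulVec, dotProduct_mulVec, vecMul_transpose]
  have hve (u w : Fin 17 → ℤ) : x ⬝ᵥ vecMulVec u w *ᵥ y = (x ⬝ᵥ u) * (w ⬝ᵥ y) := by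
    rw [vecMulVec_mulVec, dotProduct_smul]
    simp
  have hl (u : Fin 17 → ℤ) : (latticeGram *ᵥ u) ⬝ᵥ y = bform latticeGram u y := by
    rw [bform_comm latticeGram_isSymm, dotProduct_comm, bform]
  simp only [smul_mulVec, sub_mulVec, add_mulVec, dotProduct_smul, dotProduct_add,
    dotProduct_sub, htr, hve, hl, smul_eq_mul] at h
  rw [bform_comm latticeGram_isSymm cusp x, bform_comm latticeGram_isSymm coCusp x]
  simp only [bform] at h ⊢
  linear_combination h

theorem eq_zero_of_bform_eq_zero {x : Fin 17 → ℤ} (h : ∀ y, bform latticeGram y x = 0) :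
    x = 0 := by
  have h0 : latticeGram *ᵥ x = 0 := funext fun i => by
    simpa [bform] using h (Pi.single i 1)
  have h2 : (2 : Matrix (Fin 17) (Fin 17) ℤ) *ᵥ x = 0 := by
    rw [← latticeGramInv_mul_latticeGram, ← mulVec_mulVec, h0, mulVec_zero]
  funext i
  have := congrFun h2 i
  rw [ofNat_mulVec] at this
  simpa using this

theorem dvd_coordA_sub (x : Fin 17 → ℤ) (i : Fin 10) :
    4 ∣ (coordA *ᵥ x) i - (coordA *ᵥ x) 0 := by
  have : ∀ i j, 4 ∣ coordA i j - coordA 0 j := by decide +kernel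
  simp only [mulVec, ← sub_dotProduct]
  exact Finset.dvd_sum fun j _ => (this i j).mul_right _

theorem dvd_coordB_sub (x : Fin 17 → ℤ) (i : Fin 3) :
    4 ∣ (coordB *ᵥ x) i - (coordA *ᵥ x) 0 := by
  have : ∀ i j, 4 ∣ coordB i j - coordA 0 j := by decide +kernel
  simp only [mulVec, ← sub_dotProduct]
  exact Finset.dvd_sum fun j _ => (this i j).mul_right _

theorem two_dvd_sum_coordC_sub (x : Fin 17 → ℤ) :
    2 ∣ ∑ l, (coordC *ᵥ x) l - (coordA *ᵥ x) 0 := by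
  have : ∀ j, 2 ∣ (∑ l, coordC l) j - coordA 0 j := by decide +kernel
  simp only [mulVec, ← sum_dotProduct, ← sub_dotProduct]
  exact Finset.dvd_sum fun j _ => (this j).mul_right _

theorem sum_coordA_add (x : Fin 17 → ℤ) :
    ∑ i, (coordA *ᵥ x) i + 2 * ∑ j, (coordB *ᵥ x) j = 0 := by
  have : ∑ i, coordA i + (2 : ℤ) • ∑ j, coordB j = 0 := by decide +kernel
  simp only [mulVec, ← sum_dotProduct]
  rw [← smul_eq_mul, ← smul_dotProduct, ← add_dotProduct, this, zero_dotProduct]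

/-- The norm form on `cusp^⊥`. -/
theorem coord_norm {x : Fin 17 → ℤ} (hx : bform latticeGram cusp x = 0) :
    (coordA *ᵥ x) ⬝ᵥ (coordA *ᵥ x) + 2 * ((coordB *ᵥ x) ⬝ᵥ (coordB *ᵥ x)) +
      16 * ((coordC *ᵥ x) ⬝ᵥ (coordC *ᵥ x)) = -(16 * bform latticeGram x x) := by
  have := sixteen_mul_bform x x
  rw [hx] at this
  linear_combination this

theorem bform_vecA {x : Fin 17 → ℤ} (hx : bform latticeGram cusp x = 0) (i : Fin 10) :
    -(4 * bform latticeGram x (vecA i)) = (coordA *ᵥ x) i - (coordA *ᵥ x) 0 := by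
  have h := sixteen_mul_bform x (vecA i)
  have h1 : ∀ i, bform latticeGram cusp (vecA i) = 0 ∧ coordB *ᵥ vecA i = 0 ∧
      coordC *ᵥ vecA i = 0 ∧ coordA *ᵥ vecA i = Pi.single i 4 - Pi.single 0 4 := by
    decide +kernel
  obtain ⟨he, hB, hC, hA⟩ := h1 i
  simp only [hx, he, hB, hC, hA, dotProduct_zero, dotProduct_sub, dotProduct_single] at h
  linarith

theorem bform_vecC {x : Fin 17 → ℤ} (hx : bform latticeGram cusp x = 0) (l : Fin 3) :
    -bform latticeGram x (vecC l) = (coordC *ᵥ x) l - (coordC *ᵥ x) 0 := by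
  have h := sixteen_mul_bform x (vecC l)
  have h1 : ∀ i, bform latticeGram cusp (vecC i) = 0 ∧ coordA *ᵥ vecC i = 0 ∧
      coordB *ᵥ vecC i = 0 ∧ coordC *ᵥ vecC i = Pi.single i 1 - Pi.single 0 1 := by
    decide +kernel
  obtain ⟨he, hA, hB, hC⟩ := h1 l
  simp only [hx, he, hB, hC, hA, dotProduct_zero, dotProduct_sub, dotProduct_single] at h
  linarith

theorem bform_translation_eq_zero {α : Fin 17 → ℤ} (hα : IsRoot latticeGram α)
    (hx : bform latticeGram cusp α = 0) : bform latticeGram translation α = 0 := by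
  have hsum := sum_coordA_add α
  have hB : ∑ j, (coordB *ᵥ α) j = 0 := by
    refine sum_eq_zero_of_root_norm (dvd_coordA_sub α) (dvd_coordB_sub α) hsum
      (two_dvd_sum_coordC_sub α) ?_
    rw [coord_norm hx]
    refine hα.imp (fun h => by rw [h]; rfl) fun ⟨h, hd⟩ =>
      ⟨by rw [h]; rfl, fun i => ?_, fun l => ?_⟩
    · rw [← bform_vecA hx]
      have := hd (vecA i)
      omega
    · rw [← bform_vecC hx]
      exact (hd _).neg_right
  have h := sixteen_mul_bform translation α
  have h1 : bform latticeGram cusp translation = 0 ∧ coordA *ᵥ translation = (-6 : ℤ) • 1 ∧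
      coordB *ᵥ translation = (10 : ℤ) • 1 ∧ coordC *ᵥ translation = 0 := by
    decide +kernel
  obtain ⟨he, hA, hB', hC⟩ := h1
  simp only [hx, he, hA, hB', hC, smul_dotProduct, one_dotProduct, zero_dotProduct,
    smul_eq_mul] at h
  linarith

/-- A vector of `ℤ¹⁷` in general position close to the cusp. -/
def chamberPoint : Fin 17 → ℤ :=
  ((4 * 32 ^ 15 : ℤ) • coCusp + (32 ^ 17 : ℤ) • cusp : Fin 17 → ℤ) +
    ![-593604036712440600, -593603504136495896, 16776704,
      297092298032656252, 33553904, 50314736,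
      -297092297965580684, -17592152506368, -296529348045697420,
      -558446353793941504, 18014398509481984, -558155798996574472,
      17723844248461576, 9158956833468401379658, -590295810358705651712,
      -571849066284996100096, -9730509098010179475126]

theorem bform_cusp_chamberPoint : bform latticeGram cusp chamberPoint = 4 * 32 ^ 15 := by
  decide +kernel

theorem chamberPoint_sq :
    4 * (4 * 32 ^ 15) ^ 2 < bform latticeGram chamberPoint chamberPoint := by
  decide +kernel

theorem bform_chamberPoint_ge (x : Fin 17 → ℤ) :
    (4 * 32 ^ 15) ^ 2 * bform latticeGram x x +
        bform latticeGram cusp x ^ 2 * bform latticeGram chamberPoint chamberPoint ≤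
      2 * (4 * 32 ^ 15) * bform latticeGram cusp x * bform latticeGram chamberPoint x := by
  set q : ℤ := 4 * 32 ^ 15 with hq
  set y := q • x - bform latticeGram cusp x • chamberPoint with hy
  have hy0 : bform latticeGram cusp y = 0 := by
    rw [hy, bform_sub_right, bform_smul_right, bform_smul_right, bform_cusp_chamberPoint]
    ring
  have hneg : bform latticeGram y y ≤ 0 := by
    have := coord_norm hy0
    have hA := dotProduct_self_nonneg_int (coordA *ᵥ y)
    have hB := dotProduct_self_nonneg_int (coordB *ᵥ y)
    have hC := dotProduct_self_nonneg_int (coordC *ᵥ y)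
    omega
  have hexp : bform latticeGram y y = q ^ 2 * bform latticeGram x x -
      2 * q * bform latticeGram cusp x * bform latticeGram chamberPoint x +
      bform latticeGram cusp x ^ 2 * bform latticeGram chamberPoint chamberPoint := by
    rw [hy]
    simp only [bform_sub_left, bform_sub_right, bform_smul_left, bform_smul_right]
    rw [bform_comm latticeGram_isSymm x chamberPoint]
    ring
  linarith

theorem bform_chamberPoint_pos {α : Fin 17 → ℤ} (hα : IsRoot latticeGram α)
    (hX : 0 < bform latticeGram cusp α) : 0 < bform latticeGram chamberPoint α := by
  have h := bform_chamberPoint_ge α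
  have hp := chamberPoint_sq
  have hα4 : -4 ≤ bform latticeGram α α := by rcases hα with h | ⟨h, -⟩ <;> omega
  set X := bform latticeGram cusp α
  set P := bform latticeGram chamberPoint chamberPoint
  set q : ℤ := 4 * 32 ^ 15 with hq
  have hq0 : 0 < q := by norm_num [hq]
  have h1 : P ≤ X ^ 2 * P := le_mul_of_one_le_left (by nlinarith) (by nlinarith)
  have h2 : q ^ 2 * -4 ≤ q ^ 2 * bform latticeGram α α :=
    mul_le_mul_of_nonneg_left hα4 (sq_nonneg q)
  refine pos_of_mul_pos_right (a := 2 * q * X) ?_ (by positivity)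
  linarith

theorem coord_eq_zero_of_bform_self {x : Fin 17 → ℤ} (hx : bform latticeGram cusp x = 0)
    (hxx : bform latticeGram x x = 0) :
    coordA *ᵥ x = 0 ∧ coordB *ᵥ x = 0 ∧ coordC *ᵥ x = 0 := by
  have := coord_norm hx
  have hA := dotProduct_self_nonneg_int (coordA *ᵥ x)
  have hB := dotProduct_self_nonneg_int (coordB *ᵥ x)
  have hC := dotProduct_self_nonneg_int (coordC *ᵥ x)
  refine ⟨dotProduct_self_eq_zero.1 ?_, dotProduct_self_eq_zero.1 ?_,
    dotProduct_self_eq_zero.1 ?_⟩ <;> omega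

theorem bform_self_neg_of_orthogonal {x : Fin 17 → ℤ}
    (hx : bform latticeGram chamberPoint x = 0) (hx0 : x ≠ 0) : bform latticeGram x x < 0 := by
  have h := bform_chamberPoint_ge x
  have hp := chamberPoint_sq
  rw [hx, mul_zero] at h
  by_contra! hxx
  have hX : bform latticeGram cusp x = 0 := by
    by_contra hX
    have := mul_pos (pow_pos (abs_pos.2 hX) 2) ((by positivity : (0 : ℤ) ≤ _).trans_lt hp)
    rw [sq_abs] at this
    nlinarith
  have hxx0 : bform latticeGram x x = 0 := by
    rw [hX] at h
    nlinarith
  obtain ⟨hA, hB, hC⟩ := coord_eq_zero_of_bform_self hX hxx0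
  have hform (y : Fin 17 → ℤ) :
      bform latticeGram y x = bform latticeGram cusp y * bform latticeGram coCusp x := by
    have := sixteen_mul_bform y x
    rw [hA, hB, hC, hX] at this
    simp only [dotProduct_zero] at this
    linarith
  have hY : bform latticeGram coCusp x = 0 := by
    have := hform chamberPoint
    rw [hx, bform_cusp_chamberPoint] at this
    omega
  exact hx0 (eq_zero_of_bform_eq_zero fun y => by rw [hform, hY, mul_zero])

/-- On `cusp^⊥`, pairing with `chamberPoint` is a number written in base `32`. -/
theorem bform_chamberPoint_of_orthogonal {x : Fin 17 → ℤ} (hx : bform latticeGram cusp x = 0) :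
    bform latticeGram chamberPoint x = 4 * 32 ^ 15 * bform latticeGram coCusp x -
      4 * (∑ k, 32 ^ k.1 * (coordA *ᵥ x) k + 32 ^ 10 * (2 * (coordB *ᵥ x) 0) +
        32 ^ 11 * (2 * (coordB *ᵥ x) 1) + ∑ l, 32 ^ (12 + l.1) * (4 * (coordC *ᵥ x) l)) := by
  have h := sixteen_mul_bform chamberPoint x
  have hsum := sum_coordA_add x
  let t : ℤ := -(4 * (∑ k : Fin 10, 32 ^ k.1 + 2 * (32 ^ 10 + 32 ^ 11)))
  have h1 : coordA *ᵥ chamberPoint = t • 1 + (64 : ℤ) • (fun k => 32 ^ k.1) ∧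
      coordB *ᵥ chamberPoint = t • 1 + (64 : ℤ) • ![32 ^ 10, 32 ^ 11, 0] ∧
      coordC *ᵥ chamberPoint = (16 : ℤ) • (fun l => 32 ^ (12 + l.1)) := by
    decide +kernel
  obtain ⟨hA, hB, hC⟩ := h1
  rw [hA, hB, hC, hx, bform_cusp_chamberPoint] at h
  simp only [add_dotProduct, smul_dotProduct, one_dotProduct, smul_eq_mul] at h
  have hvec : ![32 ^ 10, 32 ^ 11, 0] ⬝ᵥ (coordB *ᵥ x) =
      32 ^ 10 * (coordB *ᵥ x) 0 + 32 ^ 11 * (coordB *ᵥ x) 1 := by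
    simp [dotProduct, Fin.sum_univ_three]
  have hsumC : ∑ l : Fin 3, 32 ^ (12 + l.1) * (4 * (coordC *ᵥ x) l) =
      4 * ((fun l : Fin 3 => 32 ^ (12 + l.1)) ⬝ᵥ (coordC *ᵥ x)) := by
    simp only [dotProduct, Finset.mul_sum]
    exact Finset.sum_congr rfl fun l _ => by ring
  have hsumA : ∑ k : Fin 10, 32 ^ k.1 * (coordA *ᵥ x) k =
      (fun k : Fin 10 => 32 ^ k.1) ⬝ᵥ (coordA *ᵥ x) := rfl
  rw [hsumC, hsumA]
  rw [hvec] at h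
  have ht : t * ∑ i, (coordA *ᵥ x) i + 2 * (t * ∑ j, (coordB *ᵥ x) j) = 0 := by
    linear_combination t * hsum
  linarith

theorem coord_eq_zero_of_bform_chamberPoint {α : Fin 17 → ℤ} (hα : IsRoot latticeGram α)
    (hX : bform latticeGram cusp α = 0) (hp : bform latticeGram chamberPoint α = 0) :
    coordA *ᵥ α = 0 ∧ coordB *ᵥ α = 0 ∧ coordC *ᵥ α = 0 := by
  have hnorm := coord_norm hX
  have hsum := sum_coordA_add α
  rw [bform_chamberPoint_of_orthogonal hX] at hp
  have hα4 : -4 ≤ bform latticeGram α α := by rcases hα with h | ⟨h, -⟩ <;> omega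
  have hA := dotProduct_self_nonneg_int (coordA *ᵥ α)
  have hB := dotProduct_self_nonneg_int (coordB *ᵥ α)
  have hC := dotProduct_self_nonneg_int (coordC *ᵥ α)
  have hAi (i : Fin 10) : -8 ≤ (coordA *ᵥ α) i ∧ (coordA *ᵥ α) i ≤ 8 :=
    abs_le.1 <| abs_le_of_sq_le_sq
      (by have := mul_self_le_dotProduct_self (coordA *ᵥ α) i; linarith)
      (by norm_num)
  have hBj (i : Fin 3) : -6 ≤ (coordB *ᵥ α) i ∧ (coordB *ᵥ α) i ≤ 6 :=
    abs_le.1 <| abs_le_of_sq_le_sq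
      (by have := mul_self_le_dotProduct_self (coordB *ᵥ α) i; linarith)
      (by norm_num)
  have hCl (i : Fin 3) : -2 ≤ (coordC *ᵥ α) i ∧ (coordC *ᵥ α) i ≤ 2 :=
    abs_le.1 <| abs_le_of_sq_le_sq
      (by have := mul_self_le_dotProduct_self (coordC *ᵥ α) i; linarith)
      (by norm_num)
  generalize coordA *ᵥ α = A at *
  generalize coordB *ᵥ α = B at *
  generalize coordC *ᵥ α = C at *
  obtain ⟨D, hD0, hD1⟩ : ∃ D : Fin 2 → ℤ, D 0 = 2 * B 0 ∧ D 1 = 2 * B 1 :=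
    ⟨![2 * B 0, 2 * B 1], rfl, rfl⟩
  have hd : Fin.append (Fin.append A D) ((4 : ℤ) • C) = 0 := by
    refine eq_zero_of_sum_base_eq (Y := bform latticeGram coCusp α) (fun i => ?_) ?_
    · rw [abs_le]
      induction i using Fin.addCases with
      | left i =>
        induction i using Fin.addCases with
        | left i =>
          rw [Fin.append_left, Fin.append_left]
          have := hAi i
          omega
        | right j =>
          rw [Fin.append_left, Fin.append_right]
          have h0 := hBj 0
          have h1 := hBj 1
          obtain rfl | rfl : j = 0 ∨ j = 1 := by omega
          all_goals omega
      | right l =>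
        rw [Fin.append_right, Pi.smul_apply, smul_eq_mul]
        have := hCl l
        omega
    · simp only [Fin.sum_univ_add, Fin.append_left, Fin.append_right, Fin.sum_univ_two,
        Fin.val_castAdd, Fin.val_natAdd, Pi.smul_apply, smul_eq_mul, hD0, hD1]
      simp only [Nat.reduceAdd, Fin.coe_ofNat_eq_mod, Nat.zero_mod, add_zero, Nat.one_mod]
      linarith
  have hA0 : A = 0 := funext fun i => by
    have := congrFun hd (Fin.castAdd 3 (Fin.castAdd 2 i))
    rwa [Fin.append_left, Fin.append_left] at this
  have hB0 : B 0 = 0 := by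
    have := congrFun hd (Fin.castAdd 3 (Fin.natAdd 10 0))
    rw [Fin.append_left, Fin.append_right] at this
    change D 0 = 0 at this
    omega
  have hB1 : B 1 = 0 := by
    have := congrFun hd (Fin.castAdd 3 (Fin.natAdd 10 1))
    rw [Fin.append_left, Fin.append_right] at this
    change D 1 = 0 at this
    omega
  have hC0 : C = 0 := funext fun l => by
    have := congrFun hd (Fin.natAdd 12 l)
    rw [Fin.append_right] at this
    simpa using this
  refine ⟨hA0, ?_, hC0⟩
  simp only [hA0, Pi.zero_apply, Finset.sum_const_zero, Fin.sum_univ_three, hB0, hB1] at hsum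
  ext j
  fin_cases j
  · exact hB0
  · exact hB1
  · change B 2 = 0
    omega

theorem isChamberPoint_chamberPoint : IsChamberPoint latticeGram chamberPoint where
  sq_pos := (by norm_num : (0 : ℤ) ≤ 4 * (4 * 32 ^ 15) ^ 2).trans_lt chamberPoint_sq
  neg_of_orthogonal _ := bform_self_neg_of_orthogonal
  regular α hα hp := by
    rcases lt_trichotomy (bform latticeGram cusp α) 0 with h | h | h
    · have := bform_chamberPoint_pos hα.neg (by rw [bform_neg_right]; omega)
      rw [bform_neg_right] at this
      omega
    · obtain ⟨hA, hB, hC⟩ := coord_eq_zero_of_bform_chamberPoint hα h hp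
      have hn := coord_norm h
      have := hα.bform_self_neg
      rw [hA, hB, hC] at hn
      simp only [dotProduct_zero] at hn
      omega
    · exact (bform_chamberPoint_pos hα h).ne' hp

theorem not_finiteIndex_Wr_latticeGram : ¬ (Wr 17 latticeGram).FiniteIndex :=
  not_finiteIndex_Wr_of_cusp (c := -30) latticeGram_isSymm isChamberPoint_chamberPoint
    (e := cusp) (v := translation) (by decide +kernel) (by decide +kernel) (by decide +kernel)
    (by decide +kernel) (by norm_num) (fun _ => bform_chamberPoint_pos)
    fun _ => bform_translation_eq_zero

end Cusp

/-- The lattice `U ⊕ E₇ ⊕ D₄ ⊕ D₄` is not reflective: the subgroup `W_r` of `O(S)`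
generated by the reflections in all roots has infinite index in `O(S)`. -/
theorem not_reflective_17_5_1 : ¬ (Wr _ gramS).FiniteIndex := by
  exact not_finiteIndex_Wr_latticeGram
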